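/- arXiv:1504.01946 — 5 statements merged into one kernel-verified Lean document; each statement's English description precedes it below -/
import Mathlib

section
/- Let V₁, V₂, V₃, V₄ be complex vector spaces arranged in a square with linear maps A⁺ : V₁ → V₂, A⁻ : V₂ → V₁ (bottom edge), B⁺ : V₂ → V₃, B⁻ : V₃ → V₂ (right edge), A'⁺ : V₄ → V₃, A'⁻ : V₃ → V₄ (top edge), B'⁺ : V₁ → V₄, B'⁻ : V₄ → V₁ (left edge). Assume the eight narrow circuit conditions A⁻∘A⁺ = α·id_{V₁}, A⁺∘A⁻ = α·id_{V₂}, B⁻∘B⁺ = β·id_{V₂}, B⁺∘B⁻ = β·id_{V₃}, A'⁻∘A'⁺ = α'·id_{V₄}, A'⁺∘A'⁻ = α'·id_{V₃}, B'⁻∘B'⁺ = β'·id_{V₁}, B'⁺∘B'⁻ = β'·id_{V₄}, and let γ, δ ∈ ℂ with γ·δ ≠ 0 and β'·α'·β·α = γ·δ. Then the following are equivalent: (1) the counterclockwise square circuit B'⁻ ∘ A'⁻ ∘ B⁺ ∘ A⁺ equals γ·id_{V₁}; (2) the clockwise square circuit A⁻ ∘ B⁻ ∘ A'⁺ ∘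 B'⁺ equals δ·id_{V₁}; (3) the diagram commutes up to scalar in the sense A'⁺ ∘ B'⁺ = (α'·β'/γ)·(B⁺ ∘ A⁺) as maps V₁ → V₃. -/
/-- Lemma on wide circuit endomorphisms of a square in a grid representation:
given the eight narrow circuit conditions and `β' * α' * β * α = γ * δ` with `γ * δ ≠ 0`,
the counterclockwise square circuit acting as `γ`, the clockwise square circuit acting
as `δ`, and commutativity of the diagonal up to the scalar `α' * β' / γ` are equivalent. -/
theorem wide_circuit_endomorphisms
    {V₁ V₂ V₃ V₄ : Type*}
    [AddCommGroup V₁] [Module ℂ V₁] [AddCommGroup V₂] [Module ℂ V₂]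
    [AddCommGroup V₃] [Module ℂ V₃] [AddCommGroup V₄] [Module ℂ V₄]
    (Ap : V₁ →ₗ[ℂ] V₂) (Am : V₂ →ₗ[ℂ] V₁)
    (Bp : V₂ →ₗ[ℂ] V₃) (Bm : V₃ →ₗ[ℂ] V₂)
    (A'p : V₄ →ₗ[ℂ] V₃) (A'm : V₃ →ₗ[ℂ] V₄)
    (B'p : V₁ →ₗ[ℂ] V₄) (B'm : V₄ →ₗ[ℂ] V₁)
    (α β α' β' γ δ : ℂ)
    (hA1 : Am ∘ₗ Ap = α • LinearMap.id) (hA2 : Ap ∘ₗ Am = α • LinearMap.id)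
    (hB1 : Bm ∘ₗ Bp = β • LinearMap.id) (hB2 : Bp ∘ₗ Bm = β • LinearMap.id)
    (hA'1 : A'm ∘ₗ A'p = α' • LinearMap.id) (hA'2 : A'p ∘ₗ A'm = α' • LinearMap.id)
    (hB'1 : B'm ∘ₗ B'p = β' • LinearMap.id) (hB'2 : B'p ∘ₗ B'm = β' • LinearMap.id)
    (hγδ : γ * δ ≠ 0) (hprod : β' * α' * β * α = γ * δ) :
    List.TFAE
      [ B'm ∘ₗ A'm ∘ₗ Bp ∘ₗ Ap = γ • LinearMap.id,
        Am ∘ₗ Bm ∘ₗ A'p ∘ₗ B'p = δ • LinearMap.id,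
        A'p ∘ₗ B'p = (α' * β' / γ) • (Bp ∘ₗ Ap) ] := by
  have hγ : γ ≠ 0 := left_ne_zero_of_mul hγδ
  have hδ : δ ≠ 0 := right_ne_zero_of_mul hγδ
  simp only [LinearMap.ext_iff, LinearMap.comp_apply, LinearMap.smul_apply,
    LinearMap.id_apply] at *
  tfae_have 1 → 3 := by
    intro h x
    have e := congrArg (fun y => A'p (B'p y)) (h x)
    simp only [hB'2, hA'2, map_smul, smul_smul] at e
    rw [div_eq_inv_mul, mul_smul, mul_comm α' β', e, inv_smul_smul₀ hγ]
  tfae_have 3 → 2 := by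
    intro h x
    simp only [h, map_smul, hB1, hA1, smul_smul]
    congr 1
    rw [div_mul_eq_mul_div, div_mul_eq_mul_div, div_eq_iff hγ]
    linear_combination hprod
  tfae_have 2 → 1 := by
    intro h x
    have e := congrArg (fun y => B'm (A'm (Bp (Ap y)))) (h x)
    simp only [hA2, hB2, hA'1, hB'1, map_smul, smul_smul] at e
    apply smul_right_injective V₁ hδ
    simp only [smul_smul]
    rw [← e]
    congr 1
    linear_combination hprod
  tfae_finish
end

section
/- For all n ∈ ℕ and k ∈ ℤ the following identities of linear operators on ℂ[x] hold: (−D) ∘ (k·id + X∘C) = −H_{n,k} + (n+1)·id and ((k+1)·id + X∘C) ∘ (−D) = −H_{n,k} + n·id. Moreover, the operator k·id + X∘C maps U_{n,k} into U_{n+1,k−1} and the operator −D maps U_{n,k} into U_{n−1,k+1} (for n ≥ 1); consequently on U_{n,k} the East narrow circuit (−D)∘(k·id + X∘C) acts as the scalar n+1 and the West narrow circuit ((k+1)·id + X∘C)∘(−D) acts as the scalar n. -/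
open Polynomial

/-- The differentiation operator `D` on `ℂ[x]`. -/
noncomputable def Dop : Module.End ℂ (Polynomial ℂ) := derivative

/-- Multiplication by `x` on `ℂ[x]`. -/
noncomputable def Xop : Module.End ℂ (Polynomial ℂ) := LinearMap.mulLeft ℂ X

/-- The operator `C := D - 1`. -/
noncomputable def Cop : Module.End ℂ (Polynomial ℂ) := Dop - 1

/-- The Laguerre operator `H_{n,k} := X∘C∘D + (k+1)·D + n·id`. -/
noncomputable def Hlag (n : ℕ) (k : ℤ) : Module.End ℂ (Polynomial ℂ) :=
  Xop * Cop * Dop + ((k : ℂ) + 1) • Dop + (n : ℂ) • 1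

/-- The space `U_{n,k} := ker H_{n,k} ∩ ker D^{n+1}`. -/
noncomputable def Ulag (n : ℕ) (k : ℤ) : Submodule ℂ (Polynomial ℂ) :=
  LinearMap.ker (Hlag n k) ⊓ LinearMap.ker (Dop ^ (n + 1))

theorem Dop_apply (p : Polynomial ℂ) : Dop p = derivative p := rfl

theorem east_apply (a : ℂ) (p : Polynomial ℂ) :
    (a • 1 + Xop * Cop : Module.End ℂ (Polynomial ℂ)) p = C a * p + X * (derivative p - p) := by
  rw [← smul_eq_C_mul]
  rfl

theorem Hlag_apply (n : ℕ) (k : ℤ) (p : Polynomial ℂ) :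
    Hlag n k p = X * (derivative (derivative p) - derivative p)
      + C ((k : ℂ) + 1) * derivative p + C (n : ℂ) * p := by
  rw [← smul_eq_C_mul, ← smul_eq_C_mul]
  rfl

theorem neg_Dop_east_apply (n : ℕ) (k : ℤ) (p : Polynomial ℂ) :
    -Dop (((k : ℂ) • 1 + Xop * Cop : Module.End ℂ (Polynomial ℂ)) p)
      = -Hlag n k p + ((n : ℂ) + 1) • p := by
  rw [east_apply, Hlag_apply, Dop_apply, smul_eq_C_mul]
  simp only [derivative_add, derivative_mul, derivative_sub, derivative_C, derivative_X,
    C_add, C_1]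
  ring

theorem east_neg_Dop_apply (n : ℕ) (k : ℤ) (p : Polynomial ℂ) :
    (((k : ℂ) + 1) • 1 + Xop * Cop : Module.End ℂ (Polynomial ℂ)) (-Dop p)
      = -Hlag n k p + (n : ℂ) • p := by
  rw [east_apply, Hlag_apply, Dop_apply, smul_eq_C_mul, derivative_neg]
  ring

/-- The operator `k·id + X∘C` maps `U_{n,k}` into `U_{n+1,k-1}`. -/
theorem east_mem_Ulag {n : ℕ} {k : ℤ} {p : Polynomial ℂ} (hp : p ∈ Ulag n k) :
    ((k : ℂ) • 1 + Xop * Cop : Module.End ℂ (Polynomial ℂ)) p ∈ Ulag (n + 1) (k - 1) := by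
  obtain ⟨hH, hD⟩ := hp
  replace hH : Hlag n k p = 0 := hH
  replace hD : (Dop ^ (n + 1)) p = 0 := hD
  have hE := neg_Dop_east_apply n k p
  rw [hH, neg_zero, zero_add] at hE
  refine ⟨LinearMap.mem_ker.2 ?_, LinearMap.mem_ker.2 ?_⟩
  · have h := east_neg_Dop_apply (n + 1) (k - 1)
      (((k : ℂ) • 1 + Xop * Cop : Module.End ℂ (Polynomial ℂ)) p)
    have hk : (((k - 1 : ℤ) : ℂ) + 1) = k := by push_cast; ring
    rw [hk, hE, map_smul, Nat.cast_succ] at h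
    exact neg_eq_zero.1 (right_eq_add.1 h)
  · rw [pow_succ, Module.End.mul_apply, neg_eq_iff_eq_neg.1 hE, map_neg, map_smul, hD,
      smul_zero, neg_zero]

/-- The operator `-D` maps `U_{n+1,k}` into `U_{n,k+1}`. -/
theorem neg_Dop_mem_Ulag {n : ℕ} {k : ℤ} {p : Polynomial ℂ} (hp : p ∈ Ulag (n + 1) k) :
    -Dop p ∈ Ulag n (k + 1) := by
  obtain ⟨hH, hD⟩ := hp
  replace hH : Hlag (n + 1) k p = 0 := hH
  replace hD : (Dop ^ (n + 1 + 1)) p = 0 := hD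
  have hW := east_neg_Dop_apply (n + 1) k p
  rw [hH, neg_zero, zero_add] at hW
  refine ⟨LinearMap.mem_ker.2 ?_, LinearMap.mem_ker.2 ?_⟩
  · have h := neg_Dop_east_apply n (k + 1) (-Dop p)
    have hk : ((k + 1 : ℤ) : ℂ) = k + 1 := by push_cast; ring
    rw [hk, hW, map_smul, ← smul_neg, Nat.cast_succ] at h
    exact neg_eq_zero.1 (right_eq_add.1 h)
  · rw [map_neg, ← Module.End.mul_apply, ← pow_succ, hD, neg_zero]

/-- The horizontal (East and West) narrow circuit identities of the Laguerre grid, the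
well-definedness of the horizontal arrows on `U_{n,k}`, and the resulting scalar action
of the two horizontal narrow circuit endomorphisms. -/
theorem laguerre_horizontal_circuits (n : ℕ) (k : ℤ) :
    ((-Dop) * ((k : ℂ) • 1 + Xop * Cop) = -(Hlag n k) + ((n : ℂ) + 1) • 1)
    ∧ ((((k : ℂ) + 1) • 1 + Xop * Cop) * (-Dop) = -(Hlag n k) + (n : ℂ) • 1)
    ∧ (∀ p ∈ Ulag n k, ((k : ℂ) • 1 + Xop * Cop) p ∈ Ulag (n + 1) (k - 1))
    ∧ (1 ≤ n → ∀ p ∈ Ulag n k, (-Dop) p ∈ Ulag (n - 1) (k + 1))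
    ∧ (∀ p ∈ Ulag n k, ((-Dop) * ((k : ℂ) • 1 + Xop * Cop)) p = ((n : ℂ) + 1) • p)
    ∧ (∀ p ∈ Ulag n k, ((((k : ℂ) + 1) • 1 + Xop * Cop) * (-Dop)) p = (n : ℂ) • p) := by
  refine ⟨LinearMap.ext (neg_Dop_east_apply n k), LinearMap.ext (east_neg_Dop_apply n k),
    fun p hp => east_mem_Ulag hp, ?_, fun p hp => ?_, fun p hp => ?_⟩
  · intro hn p hp
    obtain ⟨m, rfl⟩ := Nat.exists_eq_add_of_le' hn
    exact neg_Dop_mem_Ulag hp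
  · have hH : Hlag n k p = 0 := hp.1
    have h := neg_Dop_east_apply n k p
    rw [hH, neg_zero, zero_add] at h
    exact h
  · have hH : Hlag n k p = 0 := hp.1
    have h := east_neg_Dop_apply n k p
    rw [hH, neg_zero, zero_add] at h
    exact h
end

section
/- For all n, k ∈ ℕ the reflection formula (n+k)! · L_{n+k}^{−k}(x) = n! · (−x)^k · L_n^k(x) holds as an identity of polynomials; here L_{n+k}^{−k} is the associated Laguerre polynomial with lower index n+k and integer upper index −k (note (n+k) + (−k) = n ≥ 0). -/
/-- The associated Laguerre polynomial
`L_n^k(x) = Σ_{j=0}^n choose(n+k, n−j)·((−1)^j/j!)·x^j` in `ℚ[x]`. -/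
noncomputable def lagPoly (n : ℕ) (k : ℤ) : Polynomial ℚ :=
  ∑ j ∈ Finset.range (n + 1),
    Polynomial.C ((((n : ℤ) + k).toNat.choose (n - j) : ℚ) * (-1) ^ j / (Nat.factorial j : ℚ))
      * Polynomial.X ^ j

theorem Nat.factorial_mul_choose_mul_factorial_symm {n i : ℕ} (k : ℕ) (h : i ≤ n) :
    (n + k).factorial * n.choose (n - i) * i.factorial
      = n.factorial * (n + k).choose (n - i) * (k + i).factorial := by
  have h₁ := Nat.choose_mul_factorial_mul_factorial (Nat.sub_le n i)
  have h₂ := Nat.choose_mul_factorial_mul_factorial (show n - i ≤ n + k by lia)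
  rw [show n - (n - i) = i by lia] at h₁
  rw [show n + k - (n - i) = k + i by lia] at h₂
  apply Nat.eq_of_mul_eq_mul_right (Nat.factorial_pos (n - i))
  calc _ = (n + k).factorial * (n.choose (n - i) * (n - i).factorial * i.factorial) := by ring
    _ = n.factorial * ((n + k).choose (n - i) * (n - i).factorial * (k + i).factorial) := by
      rw [h₁, h₂, mul_comm]
    _ = _ := by ring

/-- Reflection across the main diagonal:
`(n+k)! · L_{n+k}^{−k} = n! · (−x)^k · L_n^k`. -/
theorem laguerre_reflection (n k : ℕ) :
    Polynomial.C ((Nat.factorial (n + k) : ℚ)) * lagPoly (n + k) (-(k : ℤ))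
      = Polynomial.C ((Nat.factorial n : ℚ)) * (-Polynomial.X) ^ k * lagPoly n k := by
  unfold lagPoly
  rw [show (((n + k : ℕ) : ℤ) + -(k : ℤ)).toNat = n by lia,
    show ((n : ℤ) + (k : ℤ)).toNat = n + k by lia,
    show n + k + 1 = k + (n + 1) by ring, Finset.sum_range_add,
    Finset.sum_eq_zero (s := Finset.range k), zero_add, Finset.mul_sum, Finset.mul_sum]
  · refine Finset.sum_congr rfl fun i hi => ?_
    have hin : i ≤ n := Nat.lt_succ_iff.mp (Finset.mem_range.mp hi)
    have key : ((n + k).factorial : ℚ) * n.choose (n - i) * i.factorial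
        = n.factorial * (n + k).choose (n - i) * (k + i).factorial := by
      exact_mod_cast Nat.factorial_mul_choose_mul_factorial_symm k hin
    have coeff : ((n + k).factorial : ℚ)
          * (n.choose (n - i) * (-1) ^ (k + i) / (k + i).factorial)
        = n.factorial * (-1) ^ k * ((n + k).choose (n - i) * (-1) ^ i / i.factorial) := by
      field_simp
      linear_combination (-1 : ℚ) ^ (k + i) * key
    have hX : (-Polynomial.X : Polynomial ℚ) ^ k
        = Polynomial.C ((-1) ^ k) * Polynomial.X ^ k := by
      rw [neg_pow, map_pow, map_neg, map_one]
    rw [show n + k - (k + i) = n - i by lia, ← mul_assoc, ← Polynomial.C_mul, coeff, hX]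
    simp only [Polynomial.C_mul]
    ring
  · intro j hj
    have hjk := Finset.mem_range.mp hj
    simp [Nat.choose_eq_zero_of_lt (show n < n + k - j by lia)]
end

section
/- Rodrigues formula: for all n, k ∈ ℕ and every real number x, n! · x^k · L_n^k(x) = e^x · (d/dx)^n (e^{−x} · x^{n+k}), where the right-hand side is the n-th derivative of the function t ↦ e^{−t} t^{n+k} evaluated at x; in particular L_n^k(x) = (1/n!)·x^{−k}·e^x·(d/dx)^n(e^{−x} x^{n+k}) for all x ≠ 0. -/
theorem aeval_lagPoly (n k : ℕ) (x : ℝ) :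
    Polynomial.aeval x (lagPoly n k)
      = ∑ j ∈ Finset.range (n + 1),
        ((n + k).choose (n - j) : ℝ) * (-1) ^ j / (Nat.factorial j : ℝ) * x ^ j := by
  have htoNat : ((n : ℤ) + k).toNat = n + k := by omega
  simp [lagPoly, htoNat]

theorem exp_mul_iteratedDeriv_exp_neg_mul_pow (n m : ℕ) (x : ℝ) :
    Real.exp x * iteratedDeriv n (fun t : ℝ => Real.exp (-t) * t ^ m) x
      = ∑ j ∈ Finset.range (n + 1),
        (n.choose j : ℝ) * (-1) ^ j * (m.descFactorial (n - j) * x ^ (m - (n - j))) := by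
  have hexp (j : ℕ) : iteratedDeriv j (fun t : ℝ => Real.exp (-t)) x
      = (-1) ^ j * Real.exp (-x) := by
    simpa using congrFun (iteratedDeriv_exp_const_mul j (-1)) x
  have hmul := iteratedDeriv_fun_mul (n := n) (x := x) (f := fun t : ℝ => Real.exp (-t))
    (g := fun t : ℝ => t ^ m) (by fun_prop) (by fun_prop)
  rw [hmul, Finset.mul_sum]
  refine Finset.sum_congr rfl fun j _ => ?_
  rw [hexp, iteratedDeriv_pow, Real.exp_neg]
  field_simp

/-- Rodrigues formula: `n! · x^k · L_n^k(x) = e^x · (d/dx)^n (e^{−x} x^{n+k})` for every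
real `x`; in particular `L_n^k(x) = (1/n!)·x^{−k}·e^x·(d/dx)^n (e^{−x} x^{n+k})` for
`x ≠ 0`. -/
theorem laguerre_rodrigues (n k : ℕ) :
    (∀ x : ℝ, (Nat.factorial n : ℝ) * x ^ k * Polynomial.aeval x (lagPoly n k)
      = Real.exp x * iteratedDeriv n (fun t : ℝ => Real.exp (-t) * t ^ (n + k)) x)
    ∧ (∀ x : ℝ, x ≠ 0 → Polynomial.aeval x (lagPoly n k)
      = (1 / (Nat.factorial n : ℝ)) * x ^ (-(k : ℤ)) * Real.exp x
          * iteratedDeriv n (fun t : ℝ => Real.exp (-t) * t ^ (n + k)) x) := by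
  have rodrigues (x : ℝ) : (Nat.factorial n : ℝ) * x ^ k * Polynomial.aeval x (lagPoly n k)
      = Real.exp x * iteratedDeriv n (fun t : ℝ => Real.exp (-t) * t ^ (n + k)) x := by
    rw [aeval_lagPoly, exp_mul_iteratedDeriv_exp_neg_mul_pow, Finset.mul_sum]
    refine Finset.sum_congr rfl fun j hj => ?_
    have hjn : j ≤ n := Nat.lt_succ_iff.mp (Finset.mem_range.mp hj)
    have hfac : (n.choose j : ℝ) * j.factorial * (n - j).factorial = n.factorial := by
      exact_mod_cast Nat.choose_mul_factorial_mul_factorial hjn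
    rw [show n + k - (n - j) = k + j by omega, Nat.descFactorial_eq_factorial_mul_choose,
      ← hfac, pow_add]
    push_cast
    field_simp
  refine ⟨rodrigues, fun x hx => ?_⟩
  rw [mul_assoc _ (Real.exp x), ← rodrigues, zpow_neg, zpow_natCast]
  field_simp
end

section
/- Rodrigues formula for Legendre–Gegenbauer polynomials: let n ∈ ℕ and let ℓ ≥ 1 be an odd natural number, and set m := (ℓ−1)/2. Then n! · (∏_{i=n}^{2n−1} (ℓ+i)) · (x²−1)^m · P_n^ℓ(x) = (∏_{i=0}^{n−1} (ℓ+2i)) · (d/dx)^n ((x²−1)^{n+m}) as an identity of polynomials in ℝ[x], where (d/dx)^n denotes n-fold differentiation of polynomials. -/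
/-- The Legendre–Gegenbauer polynomial
`P_n^ℓ(x) := Σ_{j=0}^{⌊n/2⌋} (−1)^j · (∏_{i=0}^{n−j−1} (ℓ/2 + i)) / (j!·(n−2j)!) · (2x)^{n−2j}`
in `ℝ[x]`. -/
noncomputable def gegPoly (n : ℕ) (ℓ : ℝ) : Polynomial ℝ :=
  ∑ j ∈ Finset.range (n / 2 + 1),
    Polynomial.C ((-1) ^ j * (∏ i ∈ Finset.range (n - j), (ℓ / 2 + (i : ℝ)))
        / ((Nat.factorial j : ℝ) * (Nat.factorial (n - 2 * j) : ℝ)))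
      * (Polynomial.C 2 * Polynomial.X) ^ (n - 2 * j)

open Polynomial in
/-- The Legendre–Gegenbauer polynomial solves
`(x² − 1) y'' + (ℓ + 1) x y' − n (n + ℓ) y = 0`. -/
lemma gegPoly_ode (n : ℕ) (ℓ : ℝ) (hℓ : 0 < ℓ) :
    (X ^ 2 - 1) * derivative (derivative (gegPoly n ℓ))
      + C (ℓ + 1) * X * derivative (gegPoly n ℓ) - C (n * (n + ℓ)) * gegPoly n ℓ = 0 := by
  set c : ℕ → ℝ := fun j => (-1) ^ j * (∏ i ∈ Finset.range (n - j), (ℓ / 2 + (i : ℝ)))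
        / ((Nat.factorial j : ℝ) * (Nat.factorial (n - 2 * j) : ℝ)) with hc
  set S : ℕ → ℝ[X] := fun j => if 2 * j ≤ n then
    C (c j * (2 * j * (2 * n - 2 * j + ℓ))) * (C 2 * X) ^ (n - 2 * j) else 0 with hS
  have C2 : (C 2 : ℝ[X]) = 2 := map_ofNat C 2
  have C4 : (C 4 : ℝ[X]) = 4 := map_ofNat C 4
  have hder : ∀ k : ℕ, derivative ((C 2 * X : ℝ[X]) ^ (k + 1))
      = 2 * ((k : ℝ[X]) + 1) * (C 2 * X) ^ k := by
    intro k
    rw [derivative_pow_succ]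
    simp [C2]
    ring
  have key : ∀ j ∈ Finset.range (n / 2 + 1),
      (X ^ 2 - 1) * derivative (derivative (C (c j) * (C 2 * X) ^ (n - 2 * j)))
      + C (ℓ + 1) * X * derivative (C (c j) * (C 2 * X) ^ (n - 2 * j))
      - C (n * (n + ℓ)) * (C (c j) * (C 2 * X) ^ (n - 2 * j)) = S (j + 1) - S j := by
    intro j hj
    have hj' : 2 * j ≤ n := by have := Finset.mem_range.1 hj; omega
    obtain ⟨k, rfl⟩ := Nat.exists_eq_add_of_le hj'
    have e : 2 * j + k - 2 * j = k := by omega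
    match k with
    | 0 =>
      have h1 : ¬ 2 * (j + 1) ≤ 2 * j + 0 := by omega
      simp only [hS, e, h1, if_false, hj', if_true]
      simp [C2]
      ring
    | 1 =>
      have h1 : ¬ 2 * (j + 1) ≤ 2 * j + 1 := by omega
      simp only [hS, e, h1, if_false, hj', if_true]
      simp [C2]
      ring
    | k + 2 =>
      have h1 : 2 * (j + 1) ≤ 2 * j + (k + 2) := by omega
      have e1 : 2 * j + (k + 2) - 2 * (j + 1) = k := by omega
      have hcc : c (j + 1) * (2 * (j + 1) * (2 * j + 2 * k + 2 + ℓ))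
          = - (4 * (k + 2) * (k + 1)) * c j := by
        have e2 : 2 * j + (k + 2) - j = (2 * j + (k + 2) - (j + 1)) + 1 := by omega
        have e3 : 2 * j + (k + 2) - (j + 1) = j + k + 1 := by omega
        simp only [hc, e, e1]
        rw [e2, Finset.prod_range_succ, Nat.factorial_succ, Nat.factorial_succ (k + 1),
          Nat.factorial_succ k]
        rw [e3]
        have := Nat.factorial_ne_zero j
        have := Nat.factorial_ne_zero k
        push_cast
        field_simp
        ring
      have hS1 : S (j + 1) = C (-(4 * (k + 2) * (k + 1)) * c j) * (C 2 * X) ^ k := by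
        simp only [hS, e1, h1, if_true]
        rw [← hcc]
        push_cast
        congr 3
        ring
      rw [hS1]
      simp only [hS, e, hj', if_true]
      simp only [hder, derivative_mul, derivative_add, derivative_natCast,
        derivative_one, derivative_ofNat]
      simp [C2, C4, mul_pow]
      ring
  have hsum : gegPoly n ℓ
      = ∑ j ∈ Finset.range (n / 2 + 1), C (c j) * (C 2 * X) ^ (n - 2 * j) := rfl
  rw [hsum]
  simp only [derivative_sum, Finset.mul_sum]
  rw [← Finset.sum_add_distrib, ← Finset.sum_sub_distrib, Finset.sum_congr rfl key,
    Finset.sum_range_sub]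
  have h1 : ¬ 2 * (n / 2 + 1) ≤ n := by omega
  simp [hS, h1]

open Polynomial in
lemma coeff_gegPoly_self (n : ℕ) (ℓ : ℝ) :
    (gegPoly n ℓ).coeff n
      = (∏ i ∈ Finset.range n, (ℓ / 2 + (i : ℝ))) / (Nat.factorial n : ℝ) * 2 ^ n := by
  rw [gegPoly, finsetSum_coeff, Finset.sum_eq_single 0]
  · rw [mul_pow, ← C_pow, coeff_C_mul, coeff_C_mul]
    simp
  · intro j hj hj0
    have hne : n ≠ n - 2 * j := by have := Finset.mem_range.1 hj; omega
    rw [mul_pow, ← C_pow, coeff_C_mul, coeff_C_mul, coeff_X_pow, if_neg hne]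
    simp
  · simp

open Polynomial in
lemma natDegree_gegPoly_le (n : ℕ) (ℓ : ℝ) : (gegPoly n ℓ).natDegree ≤ n := by
  refine natDegree_sum_le_of_forall_le _ _ fun j _ => ?_
  rw [mul_pow, ← C_pow]
  exact (natDegree_C_mul_le _ _).trans ((natDegree_C_mul_X_pow_le _ _).trans (Nat.sub_le _ _))

open Polynomial in
lemma X_sq_sub_one_mul_derivative_pow (N : ℕ) :
    (X ^ 2 - 1 : ℝ[X]) * derivative ((X ^ 2 - 1) ^ N)
      = 2 * (N : ℝ[X]) * X * (X ^ 2 - 1) ^ N := by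
  cases N with
  | zero => simp
  | succ N =>
    rw [derivative_pow]
    simp
    ring

open Polynomial in
/-- The differential equation satisfied by the `k`-th derivative of `(x² − 1)^N`. -/
lemma iterate_derivative_X_sq_sub_one_pow_ode (N k : ℕ) :
    (X ^ 2 - 1 : ℝ[X]) * derivative^[k + 2] ((X ^ 2 - 1) ^ N)
      + 2 * ((k : ℝ[X]) + 1 - (N : ℝ[X])) * X * derivative^[k + 1] ((X ^ 2 - 1) ^ N)
      + ((k : ℝ[X]) + 1) * ((k : ℝ[X]) - 2 * (N : ℝ[X])) * derivative^[k] ((X ^ 2 - 1) ^ N) = 0 := by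
  induction k with
  | zero =>
    have h := congrArg derivative (X_sq_sub_one_mul_derivative_pow N)
    generalize (X ^ 2 - 1 : ℝ[X]) ^ N = f at h ⊢
    simp at h ⊢
    linear_combination h
  | succ k ih =>
    have h := congrArg derivative ih
    generalize (X ^ 2 - 1 : ℝ[X]) ^ N = f at h ⊢
    simp only [Function.iterate_succ_apply'] at h ⊢
    simp at h ⊢
    linear_combination h

open Polynomial in
/-- A nonzero polynomial solution of this differential equation has degree `n + 2 m`. -/
lemma eq_zero_of_ode_of_coeff_eq_zero (n m : ℕ) (p : ℝ[X])
    (h : (X ^ 2 - 1) * derivative (derivative p) + C (2 * (1 - (m : ℝ))) * X * derivative p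
      - C (((n : ℝ) + 1) * (n + 2 * m)) * p = 0)
    (h0 : p.coeff (n + 2 * m) = 0) : p = 0 := by
  by_contra hp
  have hlc : p.coeff p.natDegree ≠ 0 := by simpa using hp
  have hz : p.coeff (p.natDegree + 2) = 0 := coeff_eq_zero_of_natDegree_lt (by omega)
  have hne : p.natDegree ≠ n + 2 * m := fun h' => hlc (h' ▸ h0)
  generalize p.natDegree = d at *
  have hd := congrArg (fun q => coeff q d) h
  have hfac : (((d : ℝ) - (n + 2 * m)) * (d + n + 1)) * p.coeff d = 0 := by
    match d with
    | 0 =>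
      simp [sub_mul, mul_assoc, coeff_derivative] at hd hz ⊢
      rw [hz] at hd
      have : ((n : ℝ) + 1) * (n + 2 * m) * p.coeff 0 = 0 := by linear_combination -hd
      have h2 : (n + 2 * m : ℝ) * (n + 1) * p.coeff 0 = 0 := by linear_combination this
      rw [← mul_eq_zero, ← mul_eq_zero]
      linear_combination -h2
    | 1 =>
      simp only [sub_mul, mul_assoc, coeff_sub, coeff_add, coeff_C_mul, coeff_X_pow_mul',
        coeff_X_mul, coeff_derivative, one_mul, coeff_zero] at hd
      norm_num at hd hz ⊢
      rw [hz] at hd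
      rw [← mul_eq_zero, ← mul_eq_zero]
      linear_combination hd
    | d + 2 =>
      simp only [sub_mul, mul_assoc, coeff_sub, coeff_add, coeff_C_mul, coeff_X_pow_mul,
        coeff_X_mul, coeff_derivative, one_mul, coeff_zero, hz] at hd
      push_cast at hd ⊢
      linear_combination hd
  have h1 : (d : ℝ) - (n + 2 * m) ≠ 0 := sub_ne_zero.2 (by exact_mod_cast hne)
  have h2 : (d : ℝ) + n + 1 ≠ 0 := by positivity
  exact mul_ne_zero (mul_ne_zero h1 h2) hlc hfac

open Polynomial in
lemma monic_X_sq_sub_one_pow (N : ℕ) : ((X ^ 2 - 1 : ℝ[X]) ^ N).Monic :=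
  (monic_X_pow_sub_C (1 : ℝ) two_ne_zero).pow N

open Polynomial in
lemma natDegree_X_sq_sub_one_pow (N : ℕ) : ((X ^ 2 - 1 : ℝ[X]) ^ N).natDegree = 2 * N := by
  have h : (X ^ 2 - 1 : ℝ[X]).natDegree = 2 := natDegree_X_pow_sub_C (r := (1 : ℝ))
  rw [natDegree_pow, h, mul_comm]

open Polynomial in
lemma coeff_X_sq_sub_one_pow (N : ℕ) : ((X ^ 2 - 1 : ℝ[X]) ^ N).coeff (2 * N) = 1 := by
  have h := (monic_X_sq_sub_one_pow N).coeff_natDegree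
  rwa [natDegree_X_sq_sub_one_pow] at h

lemma cast_descFactorial_eq_prod_Ico (n a : ℕ) :
    ((2 * n + a).descFactorial n : ℝ) = ∏ i ∈ Finset.Ico n (2 * n), (((a + 1 : ℕ) : ℝ) + i) := by
  have e : 2 * n + a = (a + n) + n := by ring
  rw [e, Nat.add_descFactorial_eq_ascFactorial, Nat.ascFactorial_eq_prod_range,
    Finset.prod_Ico_eq_prod_range]
  push_cast
  have e' : 2 * n - n = n := by omega
  rw [e']
  exact Finset.prod_congr rfl fun i _ => by ring

open Polynomial in
lemma gegenbauer_rodrigues_two_mul_add_one (n m : ℕ) :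
    C ((n.factorial : ℝ) * ∏ i ∈ Finset.Ico n (2 * n), (((2 * m + 1 : ℕ) : ℝ) + (i : ℝ)))
        * (X ^ 2 - 1) ^ m * gegPoly n ((2 * m + 1 : ℕ) : ℝ)
      = C (∏ i ∈ Finset.range n, (((2 * m + 1 : ℕ) : ℝ) + 2 * (i : ℝ)))
        * derivative^[n] ((X ^ 2 - 1) ^ (n + m)) := by
  rw [← sub_eq_zero]
  have hy := gegPoly_ode n ((2 * m + 1 : ℕ) : ℝ) (by positivity)
  have hw := X_sq_sub_one_mul_derivative_pow m
  have hw' := congrArg derivative hw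
  have hg := iterate_derivative_X_sq_sub_one_pow_ode (n + m) n
  apply eq_zero_of_ode_of_coeff_eq_zero n m
  · simp only [Function.iterate_succ_apply'] at hg
    generalize derivative^[n] ((X ^ 2 - 1 : ℝ[X]) ^ (n + m)) = g at hg ⊢
    generalize gegPoly n ((2 * m + 1 : ℕ) : ℝ) = y at hy ⊢
    generalize (X ^ 2 - 1 : ℝ[X]) ^ m = w at hw hw' ⊢
    generalize (n.factorial : ℝ) * _ = a
    generalize (∏ i ∈ Finset.range n, _ : ℝ) = b
    have C2 : (C 2 : ℝ[X]) = 2 := map_ofNat C 2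
    simp [C2] at hw' hg hy ⊢
    linear_combination C a * w * hy + C a * y * hw' + 2 * C a * derivative y * hw - C b * hg
  · rw [coeff_sub, mul_assoc, coeff_C_mul, coeff_C_mul, coeff_iterate_derivative,
      show n + 2 * m + n = 2 * (n + m) by ring, coeff_X_sq_sub_one_pow, add_comm n (2 * m),
      coeff_mul_add_eq_of_natDegree_le (natDegree_X_sq_sub_one_pow m).le
        (natDegree_gegPoly_le n _), coeff_X_sq_sub_one_pow, coeff_gegPoly_self,
      show 2 * (n + m) = 2 * n + 2 * m by ring, nsmul_eq_mul, cast_descFactorial_eq_prod_Ico]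
    have hprod : ∏ i ∈ Finset.range n, (((2 * m + 1 : ℕ) : ℝ) + 2 * (i : ℝ))
        = (∏ i ∈ Finset.range n, (((2 * m + 1 : ℕ) : ℝ) / 2 + (i : ℝ))) * 2 ^ n := by
      rw [← Finset.card_range n, ← Finset.prod_const, Finset.card_range, ← Finset.prod_mul_distrib]
      exact Finset.prod_congr rfl fun i _ => by ring
    rw [hprod]
    have := Nat.factorial_ne_zero n
    field_simp
    ring

/-- Rodrigues formula for the Legendre–Gegenbauer polynomials: for odd `ℓ ≥ 1` and
`m = (ℓ−1)/2`,
`n! · (∏_{i=n}^{2n−1} (ℓ+i)) · (x²−1)^m · P_n^ℓ = (∏_{i=0}^{n−1} (ℓ+2i)) · Dⁿ((x²−1)^{n+m})`. -/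
theorem gegenbauer_rodrigues (n : ℕ) (ℓ : ℕ) (hodd : Odd ℓ) (hl : 1 ≤ ℓ) :
    Polynomial.C ((Nat.factorial n : ℝ) * ∏ i ∈ Finset.Ico n (2 * n), ((ℓ : ℝ) + (i : ℝ)))
        * (Polynomial.X ^ 2 - 1) ^ ((ℓ - 1) / 2) * gegPoly n (ℓ : ℝ)
      = Polynomial.C (∏ i ∈ Finset.range n, ((ℓ : ℝ) + 2 * (i : ℝ)))
        * ((Polynomial.derivative : Module.End ℝ (Polynomial ℝ)) ^ n)
            ((Polynomial.X ^ 2 - 1) ^ (n + (ℓ - 1) / 2)) := by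
  obtain ⟨m, rfl⟩ := hodd
  have hm : (2 * m + 1 - 1) / 2 = m := by omega
  rw [hm, Module.End.pow_apply]
  exact gegenbauer_rodrigues_two_mul_add_one n m
end
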